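/- For every real m ≥ 0, the metric space (M(m), W_2) is complete: every sequence (μ_n) in M(m) that is Cauchy with respect to W_2 converges in W_2 to some μ ∈ M(m). -/

import Mathlib

open MeasureTheory Set Filter

noncomputable section

/-- `ℝ^d` with the Euclidean norm. -/
abbrev Euc (d : ℕ) := EuclideanSpace ℝ (Fin d)

/-- The bounded metric `ρ(x,y) = min (1, ‖x - y‖)`. -/
def rho {d : ℕ} (x y : Euc d) : ℝ := min 1 (dist x y)

/-- `M(m)`: finite nonnegative Borel measures on `ℝ^d` with total mass `m`. -/
def Mset (d : ℕ) (m : ℝ) : Set (Measure (Euc d)) :=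
  {μ | μ Set.univ = ENNReal.ofReal m}

/-- `H(μ,ν)`: joint representations of the pair `(μ,ν)`, where `μ, ν ∈ M(m)`. -/
def Hrep {d : ℕ} (m : ℝ) (μ ν : Measure (Euc d)) : Set (Measure (Euc d × Euc d)) :=
  {Q | ∀ A : Set (Euc d), MeasurableSet A →
      Q (A ×ˢ Set.univ) = ENNReal.ofReal m * μ A ∧
      Q (Set.univ ×ˢ A) = ENNReal.ofReal m * ν A}

/-- The Wasserstein distance `W_p` on `M(m)` associated with the metric `ρ`. -/
def Wp {d : ℕ} (p m : ℝ) (μ ν : Measure (Euc d)) : ℝ :=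
  sInf ((fun Q : Measure (Euc d × Euc d) => ∫ z, rho z.1 z.2 ^ p ∂Q) '' Hrep m μ ν) ^ (1 / p)

/-- The metric `γ_p` on `M(m₁,m₂) = M(m₁) × M(m₂)`. -/
def gammap {d : ℕ} (p m₁ m₂ : ℝ) (x y : Measure (Euc d) × Measure (Euc d)) : ℝ :=
  (Wp p m₁ x.1 y.1 ^ p + Wp p m₂ x.2 y.2 ^ p) ^ (1 / p)

/-- The quadratic cost as a bounded continuous function. -/
def costB (d : ℕ) : BoundedContinuousFunction (Euc d × Euc d) ℝ :=
  BoundedContinuousFunction.ofNormedAddCommGroup (fun z => rho z.1 z.2 ^ (2 : ℝ))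
    (by
      unfold rho
      refine Continuous.rpow_const (by fun_prop) (fun _ => Or.inr (by norm_num)))
    1 (by
      intro z
      have h0 : 0 ≤ rho z.1 z.2 := le_min zero_le_one dist_nonneg
      have h1 : rho z.1 z.2 ≤ 1 := min_le_left _ _
      rw [Real.norm_of_nonneg (Real.rpow_nonneg h0 _)]
      exact Real.rpow_le_one h0 h1 (by norm_num))

lemma costB_apply {d : ℕ} (z : Euc d × Euc d) : costB d z = rho z.1 z.2 ^ (2 : ℝ) := rfl

lemma costB_nonneg {d : ℕ} (z : Euc d × Euc d) : 0 ≤ costB d z :=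
  Real.rpow_nonneg (le_min zero_le_one dist_nonneg) _

lemma costB_eq_one {d : ℕ} (z : Euc d × Euc d) (h : 1 ≤ dist z.1 z.2) : costB d z = 1 := by
  rw [costB_apply, rho, min_eq_left h, Real.one_rpow]

/-- `π` is a coupling of the probability measures `P`, `P'`. -/
def IsCpl {d : ℕ} (π : ProbabilityMeasure (Euc d × Euc d)) (P P' : ProbabilityMeasure (Euc d)) :
    Prop :=
  (π : Measure (Euc d × Euc d)).fst = P ∧ (π : Measure (Euc d × Euc d)).snd = P'

lemma tail_le {d : ℕ} {π : ProbabilityMeasure (Euc d × Euc d)} {P P' : ProbabilityMeasure (Euc d)}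
    (h : IsCpl π P P') (r : ℝ) :
    (P : Measure (Euc d)) {x | r < ‖x‖} ≤ (P' : Measure (Euc d)) {x | r - 1 < ‖x‖}
      + ENNReal.ofReal (∫ z, costB d z ∂(π : Measure (Euc d × Euc d))) := by
  have hm : ∀ s : ℝ, MeasurableSet {x : Euc d | s < ‖x‖} := fun s =>
    measurableSet_lt measurable_const measurable_norm
  rw [← h.1, ← h.2, Measure.fst_apply (hm _), Measure.snd_apply (hm _)]
  have hsub : Prod.fst ⁻¹' {x : Euc d | r < ‖x‖} ⊆
      (Prod.snd ⁻¹' {x : Euc d | r - 1 < ‖x‖}) ∪ {z : Euc d × Euc d | 1 ≤ costB d z} := by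
    rintro ⟨x, y⟩ hx
    simp only [mem_preimage, mem_setOf_eq, mem_union] at hx ⊢
    by_cases hd : 1 ≤ dist x y
    · right; exact (costB_eq_one (x, y) hd).ge
    · left
      have := norm_sub_norm_le x y
      rw [dist_eq_norm] at hd
      linarith
  refine (measure_mono hsub).trans ((measure_union_le _ _).trans ?_)
  gcongr
  have := mul_meas_ge_le_integral_of_nonneg (μ := (π : Measure (Euc d × Euc d)))
    (f := costB d) (Eventually.of_forall costB_nonneg) ((costB d).integrable _) 1
  rw [one_mul] at this
  rw [← ENNReal.ofReal_toReal (measure_ne_top (π : Measure (Euc d × Euc d)) _)]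
  exact ENNReal.ofReal_le_ofReal this

lemma tight_of_cauchy {d : ℕ} (P : ℕ → ProbabilityMeasure (Euc d))
    (h : ∀ ε : ℝ, 0 < ε → ∃ N : ℕ, ∀ n ≥ N, ∀ k ≥ N, ∃ π, IsCpl π (P n) (P k) ∧
      ∫ z, costB d z ∂(π : Measure (Euc d × Euc d)) ≤ ε) :
    IsTightMeasureSet (Set.range fun n => (P n : Measure (Euc d))) := by
  apply isTightMeasureSet_range_of_tendsto_limsup_measure_norm_gt
  rw [ENNReal.tendsto_atTop_zero]
  intro ε hε
  have hε2 : 0 < ε / 2 := ENNReal.half_pos hε.ne'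
  obtain ⟨e, he0, he⟩ := ENNReal.lt_iff_exists_nnreal_btwn.1 hε2
  obtain ⟨N, hN⟩ := h e (by exact_mod_cast he0)
  have ht : IsTightMeasureSet {(P N : Measure (Euc d))} := isTightMeasureSet_singleton
  rw [isTightMeasureSet_iff_tendsto_measure_norm_gt, ENNReal.tendsto_atTop_zero] at ht
  obtain ⟨r0, hr0⟩ := ht _ hε2
  refine ⟨r0 + 1, fun r hr => ?_⟩
  refine limsup_le_of_le (by isBoundedDefault) ?_
  filter_upwards [eventually_ge_atTop N] with n hn
  obtain ⟨π, hπ, hc⟩ := hN n hn N le_rfl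
  refine (tail_le hπ r).trans ?_
  rw [← ENNReal.add_halves ε]
  gcongr
  · simpa using hr0 (r - 1) (by linarith)
  · refine (ENNReal.ofReal_le_ofReal hc).trans ?_
    rw [ENNReal.ofReal_coe_nnreal]
    exact he.le

lemma core {d : ℕ} (P : ℕ → ProbabilityMeasure (Euc d))
    (h : ∀ ε : ℝ, 0 < ε → ∃ N : ℕ, ∀ n ≥ N, ∀ k ≥ N, ∃ π, IsCpl π (P n) (P k) ∧
      ∫ z, costB d z ∂(π : Measure (Euc d × Euc d)) ≤ ε) :
    ∃ P' : ProbabilityMeasure (Euc d), ∀ ε : ℝ, 0 < ε → ∃ N : ℕ, ∀ n ≥ N, ∃ π, IsCpl π (P n) P' ∧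
      ∫ z, costB d z ∂(π : Measure (Euc d × Euc d)) ≤ ε := by
  have ht := tight_of_cauchy P h
  have hcomp : IsCompact (closure (Set.range P)) := by
    apply isCompact_closure_of_isTightMeasureSet
    refine ht.subset ?_
    rintro _ ⟨_, ⟨n, rfl⟩, rfl⟩
    exact ⟨n, rfl⟩
  obtain ⟨P', -, φ, hφ, hlim⟩ := hcomp.tendsto_subseq (x := P) (fun n => subset_closure ⟨n, rfl⟩)
  refine ⟨P', fun ε hε => ?_⟩
  obtain ⟨N, hN⟩ := h ε hε
  refine ⟨N, fun n hn => ?_⟩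
  have hk : ∀ k, N ≤ φ (k + N) := fun k => (Nat.le_add_left N k).trans (hφ.id_le _)
  choose π hπ hc using fun k => hN n hn (φ (k + N)) (hk k)
  have hcomp2 : IsCompact (closure (Set.range π)) := by
    apply isCompact_closure_of_isTightMeasureSet
    apply IsTightMeasureSet.prodMk
    · refine ht.subset ?_
      rintro _ ⟨_, ⟨_, ⟨k, rfl⟩, rfl⟩, rfl⟩
      exact ⟨n, (hπ k).1.symm⟩
    · refine ht.subset ?_
      rintro _ ⟨_, ⟨_, ⟨k, rfl⟩, rfl⟩, rfl⟩
      exact ⟨_, (hπ k).2.symm⟩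
  obtain ⟨π', -, ψ, hψ, hlim2⟩ := hcomp2.tendsto_subseq (x := π) (fun n => subset_closure ⟨n, rfl⟩)
  refine ⟨π', ⟨?_, ?_⟩, ?_⟩
  · have h1 := ProbabilityMeasure.tendsto_map_of_tendsto_of_continuous _ _ hlim2
      (continuous_fst (X := Euc d) (Y := Euc d))
    have h2 : (fun i => ((π ∘ ψ) i).map
        (continuous_fst (X := Euc d) (Y := Euc d)).measurable.aemeasurable) = fun _ => P n := by
      funext i
      apply Subtype.ext
      exact (hπ (ψ i)).1
    rw [h2] at h1
    have := tendsto_nhds_unique h1 tendsto_const_nhds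
    exact congrArg (fun q : ProbabilityMeasure (Euc d) => (q : Measure (Euc d))) this
  · have h1 := ProbabilityMeasure.tendsto_map_of_tendsto_of_continuous _ _ hlim2
      (continuous_snd (X := Euc d) (Y := Euc d))
    have h2 : (fun i => ((π ∘ ψ) i).map
        (continuous_snd (X := Euc d) (Y := Euc d)).measurable.aemeasurable)
        = fun i => (P ∘ φ) (ψ i + N) := by
      funext i
      apply Subtype.ext
      exact (hπ (ψ i)).2
    rw [h2] at h1
    have h3 : Tendsto (fun i => (P ∘ φ) (ψ i + N)) atTop (nhds P') :=
      hlim.comp (tendsto_atTop_mono (fun i => Nat.le_add_right _ N) hψ.tendsto_atTop)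
    have := tendsto_nhds_unique h1 h3
    exact congrArg (fun q : ProbabilityMeasure (Euc d) => (q : Measure (Euc d))) this
  · exact le_of_tendsto (ProbabilityMeasure.tendsto_iff_forall_integral_tendsto.1 hlim2 (costB d))
      (Eventually.of_forall fun i => hc (ψ i))

lemma Wp_nonneg {d : ℕ} (m : ℝ) (μ ν : Measure (Euc d)) : 0 ≤ Wp 2 m μ ν := by
  apply Real.rpow_nonneg
  apply Real.sInf_nonneg
  rintro _ ⟨Q, -, rfl⟩
  exact integral_nonneg (fun z => costB_nonneg z)

/-- From small `Wp` to a probability coupling with small cost. -/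
lemma exists_cpl {d : ℕ} {m : ℝ} (hm : 0 < m) {P P' : ProbabilityMeasure (Euc d)}
    {ε : ℝ} (h : Wp 2 m (ENNReal.ofReal m • (P : Measure (Euc d)))
      (ENNReal.ofReal m • (P' : Measure (Euc d))) < ε) :
    ∃ π, IsCpl π P P' ∧ ∫ z, costB d z ∂(π : Measure (Euc d × Euc d)) ≤ (m ^ 2)⁻¹ * ε ^ 2 := by
  set c := ENNReal.ofReal m with hc
  have hc0 : c ≠ 0 := by simpa [hc] using hm
  have hct : c ≠ ⊤ := ENNReal.ofReal_ne_top
  have hcc0 : c * c ≠ 0 := mul_ne_zero hc0 hc0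
  have hcct : c * c ≠ ⊤ := ENNReal.mul_ne_top hct hct
  have hne : (Hrep m (c • (P : Measure (Euc d))) (c • (P' : Measure (Euc d)))).Nonempty := by
    refine ⟨(c • (P : Measure (Euc d))).prod (c • (P' : Measure (Euc d))), fun A hA => ?_⟩
    have : SFinite (c • (P' : Measure (Euc d))) := inferInstance
    simp [Measure.prod_prod, ← hc, mul_comm]
  have hε : 0 < ε := (Wp_nonneg _ _ _).trans_lt h
  set S := (fun Q : Measure (Euc d × Euc d) => ∫ z, rho z.1 z.2 ^ (2 : ℝ) ∂Q) ''
    Hrep m (c • (P : Measure (Euc d))) (c • (P' : Measure (Euc d))) with hS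
  have hS0 : 0 ≤ sInf S := by
    apply Real.sInf_nonneg
    rintro _ ⟨Q, -, rfl⟩
    exact integral_nonneg (fun z => costB_nonneg z)
  have hlt : sInf S < ε ^ 2 := by
    have h' : (sInf S) ^ (1 / (2 : ℝ)) < ε := h
    rw [← Real.sqrt_eq_rpow] at h'
    rwa [Real.sqrt_lt' hε] at h'
  obtain ⟨_, ⟨Q, hQ, rfl⟩, hlt2⟩ := exists_lt_of_csInf_lt (hne.image _) hlt
  have key : ∀ x : ENNReal, (c * c)⁻¹ * (c * (c * x)) = x := fun x => by
    rw [← mul_assoc c c x, ← mul_assoc, ENNReal.inv_mul_cancel hcc0 hcct, one_mul]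
  have hprob : IsProbabilityMeasure ((c * c)⁻¹ • Q) := by
    constructor
    have := (hQ univ MeasurableSet.univ).1
    rw [univ_prod_univ] at this
    rw [Measure.smul_apply, this]
    simpa [← hc] using key 1
  refine ⟨⟨(c * c)⁻¹ • Q, hprob⟩, ⟨?_, ?_⟩, ?_⟩
  · ext A hA
    rw [Measure.fst_apply hA, ← prod_univ]
    simp only [ProbabilityMeasure.coe_mk, Measure.smul_apply, smul_eq_mul, (hQ A hA).1]
    exact key _
  · ext A hA
    rw [Measure.snd_apply hA, ← univ_prod]
    simp only [ProbabilityMeasure.coe_mk, Measure.smul_apply, smul_eq_mul, (hQ A hA).2]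
    exact key _
  · rw [ProbabilityMeasure.coe_mk, integral_smul_measure]
    have : ((c * c)⁻¹).toReal = (m ^ 2)⁻¹ := by
      rw [ENNReal.toReal_inv, ENNReal.toReal_mul, hc, ENNReal.toReal_ofReal hm.le, sq]
    rw [this, smul_eq_mul]
    gcongr
    exact hlt2.le

/-- From a probability coupling to a bound on `Wp`. -/
lemma Wp_le {d : ℕ} {m : ℝ} (hm : 0 < m) {P P' : ProbabilityMeasure (Euc d)}
    {π : ProbabilityMeasure (Euc d × Euc d)} (h : IsCpl π P P') :
    Wp 2 m (ENNReal.ofReal m • (P : Measure (Euc d))) (ENNReal.ofReal m • (P' : Measure (Euc d)))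
      ≤ Real.sqrt (m ^ 2 * ∫ z, costB d z ∂(π : Measure (Euc d × Euc d))) := by
  set c := ENNReal.ofReal m with hc
  rw [Wp, ← Real.sqrt_eq_rpow]
  apply Real.sqrt_le_sqrt
  refine csInf_le ⟨0, ?_⟩ ⟨(c * c) • (π : Measure (Euc d × Euc d)), fun A hA => ⟨?_, ?_⟩, ?_⟩
  · rintro _ ⟨Q, -, rfl⟩
    exact integral_nonneg (fun z => costB_nonneg z)
  · rw [← h.1, Measure.smul_apply, Measure.smul_apply, Measure.fst_apply hA, ← prod_univ,
      smul_eq_mul, smul_eq_mul, mul_assoc]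
  · rw [← h.2, Measure.smul_apply, Measure.smul_apply, Measure.snd_apply hA, ← univ_prod,
      smul_eq_mul, smul_eq_mul, mul_assoc]
  · simp only [integral_smul_measure]
    rw [ENNReal.toReal_mul, hc, ENNReal.toReal_ofReal hm.le, ← sq, smul_eq_mul]
    rfl

/-- `(M(m), W_2)` is complete. -/
theorem Mset_W2_complete {d : ℕ} (hd : 1 ≤ d) (m : ℝ) (hm : 0 ≤ m)
    (μs : ℕ → Measure (Euc d)) (hμs : ∀ n, μs n ∈ Mset d m)
    (hcauchy : ∀ ε : ℝ, 0 < ε → ∃ N : ℕ, ∀ n ≥ N, ∀ k ≥ N, Wp 2 m (μs n) (μs k) < ε) :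
    ∃ μ ∈ Mset d m, Tendsto (fun n => Wp 2 m (μs n) μ) atTop (nhds 0) := by
  rcases hm.eq_or_lt with rfl | hm
  · have hz : ∀ n, μs n = 0 := fun n => by
      have := hμs n
      simpa [Mset] using this
    refine ⟨0, by simp [Mset], ?_⟩
    have : ∀ n, Wp 2 0 (μs n) 0 = 0 := by
      intro n
      have himg : (fun Q : Measure (Euc d × Euc d) => ∫ z, rho z.1 z.2 ^ (2 : ℝ) ∂Q) ''
          Hrep 0 (μs n) 0 = {0} := by
        ext x
        simp only [mem_image, mem_singleton_iff]
        constructor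
        · rintro ⟨Q, hQ, rfl⟩
          have := (hQ univ MeasurableSet.univ).1
          rw [univ_prod_univ] at this
          have hQ0 : Q = 0 := by simpa using this
          simp [hQ0]
        · rintro rfl
          exact ⟨0, fun A _ => by simp, by simp⟩
      rw [Wp, himg, csInf_singleton]
      norm_num
    simp [this]
  set c := ENNReal.ofReal m with hc
  have hc0 : c ≠ 0 := by simpa [hc] using hm
  have hct : c ≠ ⊤ := ENNReal.ofReal_ne_top
  have hprob : ∀ n, IsProbabilityMeasure (c⁻¹ • μs n) := fun n => ⟨by
    have : μs n univ = c := hμs n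
    rw [Measure.smul_apply, this, smul_eq_mul, ENNReal.inv_mul_cancel hc0 hct]⟩
  let P : ℕ → ProbabilityMeasure (Euc d) := fun n => ⟨c⁻¹ • μs n, hprob n⟩
  have hP : ∀ n, μs n = c • (P n : Measure (Euc d)) := fun n => by
    change μs n = c • (c⁻¹ • μs n)
    rw [smul_smul, ENNReal.mul_inv_cancel hc0 hct, one_smul]
  obtain ⟨P', hP'⟩ := core P (by
    intro ε hε
    have hpos : 0 < m * Real.sqrt ε := mul_pos hm (Real.sqrt_pos.2 hε)
    obtain ⟨N, hN⟩ := hcauchy _ hpos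
    refine ⟨N, fun n hn k hk => ?_⟩
    have h1 := hN n hn k hk
    rw [hP n, hP k] at h1
    obtain ⟨π, hπ, hle⟩ := exists_cpl hm h1
    refine ⟨π, hπ, hle.trans_eq ?_⟩
    rw [mul_pow, Real.sq_sqrt hε.le]
    field_simp)
  refine ⟨c • (P' : Measure (Euc d)), by simp [Mset, ← hc], ?_⟩
  rw [Metric.tendsto_atTop]
  intro ε hε
  obtain ⟨N, hN⟩ := hP' ((m ^ 2)⁻¹ * (ε / 2) ^ 2) (by positivity)
  refine ⟨N, fun n hn => ?_⟩
  obtain ⟨π, hπ, hle⟩ := hN n hn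
  rw [Real.dist_eq, sub_zero, abs_of_nonneg (Wp_nonneg _ _ _), hP n]
  refine (Wp_le hm hπ).trans_lt ?_
  rw [Real.sqrt_lt' hε]
  calc m ^ 2 * ∫ z, costB d z ∂(π : Measure (Euc d × Euc d))
      ≤ m ^ 2 * ((m ^ 2)⁻¹ * (ε / 2) ^ 2) := by gcongr
    _ = (ε / 2) ^ 2 := by field_simp
    _ < ε ^ 2 := by nlinarith
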